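/- arXiv:1005.0667 — 5 statements merged into one kernel-verified Lean document; each statement's English description precedes it below -/
import Mathlib

section
/- Let n ≥ 2 and α ≥ 1. Let R, A_f, A_b be n×n complex matrices, Φ an n×α complex matrix and Ψ an α×n complex matrix satisfying the Sylvester displacement equation A_f R − R A_b = ΦΨ. Assume the first row of A_f vanishes off the diagonal (i.e. (A_f)_{1,j} = 0 for all j ≥ 2), the first column of A_b vanishes off the diagonal (i.e. (A_b)_{i,1} = 0 for all i ≥ 2), and d := R_{1,1} ≠ 0. Write y = R_{2:n,1} (the first column of R below the pivot), wᵀ = R_{1,2:n} (the first row of R right of the pivot), and let R₂ = R_{2:n,2:n} − (1/d)·y·wᵀ be the Schur complement of d in R. Then R₂ satisfies the Sylvester equation A_{f,2} R₂ − R₂ A_{b,2} = Φ⁽²⁾ Ψ⁽²⁾, where A_{f,2} = (A_f)_{2:n,2:n} and A_{b,2} = (A_b)_{2:n,2:n} are A_f and A_b with their first rows and columns deleted, Φ⁽²⁾ = Φ_{2:n,:} − (1/d)·y·Φ_{1,:}, and Ψ⁽²⁾ = Ψ_{:,2:n} − (1/d)·Ψ_{:,1}·wᵀ. -/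
/-- **Schur complementation preserves displacement structure** (GKO, Theorem 2.1).
If `A_f R - R A_b = Φ Ψ`, the first row of `A_f` and first column of `A_b` vanish off
the diagonal, and the pivot `d = R 0 0` is nonzero, then the Schur complement
`R₂ = R_{2:n,2:n} - y wᵀ / d` satisfies the Sylvester equation with
`A_{f,2}, A_{b,2}` (first rows/columns deleted) and updated generators
`Φ⁽²⁾ = Φ_{2:n,:} - y Φ_{1,:} / d`, `Ψ⁽²⁾ = Ψ_{:,2:n} - Ψ_{:,1} wᵀ / d`.
Here the matrix order is `n + 1 ≥ 2` and the generator width is `α ≥ 1`. -/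
theorem schur_complement_displacement
    (n α : ℕ) (hn : 1 ≤ n) (hα : 1 ≤ α)
    (R Af Ab : Matrix (Fin (n + 1)) (Fin (n + 1)) ℂ)
    (Φ : Matrix (Fin (n + 1)) (Fin α) ℂ) (Ψ : Matrix (Fin α) (Fin (n + 1)) ℂ)
    (hdisp : Af * R - R * Ab = Φ * Ψ)
    (hAf : ∀ j : Fin (n + 1), j ≠ 0 → Af 0 j = 0)
    (hAb : ∀ i : Fin (n + 1), i ≠ 0 → Ab i 0 = 0)
    (hd : R 0 0 ≠ 0) :
    (Matrix.of fun i j : Fin n => Af i.succ j.succ) *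
        (Matrix.of fun i j : Fin n =>
          R i.succ j.succ - R i.succ 0 * R 0 j.succ / R 0 0) -
      (Matrix.of fun i j : Fin n =>
          R i.succ j.succ - R i.succ 0 * R 0 j.succ / R 0 0) *
        (Matrix.of fun i j : Fin n => Ab i.succ j.succ) =
      (Matrix.of fun (i : Fin n) (a : Fin α) =>
          Φ i.succ a - R i.succ 0 * Φ 0 a / R 0 0) *
        (Matrix.of fun (a : Fin α) (j : Fin n) =>
          Ψ a j.succ - Ψ a 0 * R 0 j.succ / R 0 0) := by
  ext i j
  have h1 := congrFun (congrFun hdisp i.succ) j.succ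
  have h2 := congrFun (congrFun hdisp i.succ) 0
  have h3 := congrFun (congrFun hdisp 0) j.succ
  have h4 := congrFun (congrFun hdisp 0) 0
  have a0 : ∀ k : Fin n, Af 0 k.succ = 0 := fun k => hAf _ (Fin.succ_ne_zero k)
  have b0 : ∀ k : Fin n, Ab k.succ 0 = 0 := fun k => hAb _ (Fin.succ_ne_zero k)
  simp only [Matrix.sub_apply, Matrix.mul_apply, Fin.sum_univ_succ, a0, b0, zero_mul, mul_zero,
    Finset.sum_const_zero, add_zero] at h1 h2 h3 h4
  simp only [Matrix.sub_apply, Matrix.mul_apply, Matrix.of_apply]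
  have e1 : ∑ k : Fin n, Af i.succ k.succ *
      (R k.succ j.succ - R k.succ 0 * R 0 j.succ / R 0 0) =
      ∑ k : Fin n, Af i.succ k.succ * R k.succ j.succ -
      (∑ k : Fin n, Af i.succ k.succ * R k.succ 0) * (R 0 j.succ / R 0 0) := by
    rw [Finset.sum_mul, ← Finset.sum_sub_distrib]
    exact Finset.sum_congr rfl fun k _ => by ring
  have e2 : ∑ k : Fin n, (R i.succ k.succ - R i.succ 0 * R 0 k.succ / R 0 0) *
      Ab k.succ j.succ =
      ∑ k : Fin n, R i.succ k.succ * Ab k.succ j.succ -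
      (∑ k : Fin n, R 0 k.succ * Ab k.succ j.succ) * (R i.succ 0 / R 0 0) := by
    rw [Finset.sum_mul, ← Finset.sum_sub_distrib]
    exact Finset.sum_congr rfl fun k _ => by ring
  have e3 : ∑ a : Fin α, (Φ i.succ a - R i.succ 0 * Φ 0 a / R 0 0) *
      (Ψ a j.succ - Ψ a 0 * R 0 j.succ / R 0 0) =
      ∑ a : Fin α, Φ i.succ a * Ψ a j.succ -
      (∑ a : Fin α, Φ i.succ a * Ψ a 0) * (R 0 j.succ / R 0 0) -
      (∑ a : Fin α, Φ 0 a * Ψ a j.succ) * (R i.succ 0 / R 0 0) +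
      (∑ a : Fin α, Φ 0 a * Ψ a 0) * (R i.succ 0 * R 0 j.succ / (R 0 0) ^ 2) := by
    simp only [Finset.sum_mul]
    rw [← Finset.sum_sub_distrib, ← Finset.sum_sub_distrib, ← Finset.sum_add_distrib]
    exact Finset.sum_congr rfl fun k _ => by ring
  rw [e1, e2, e3, ← h1, ← h2, ← h3, ← h4]
  field_simp
  ring
end

section
/- Let n ≥ 2, α ≥ 1, and let t, s ∈ ℂⁿ satisfy t_i ≠ s_j for all i, j. Let R be an n×n complex matrix, Φ an n×α matrix and Ψ an α×n matrix with D_t R − R D_s = ΦΨ, where D_t = diag(t₁,…,t_n) and D_s = diag(s₁,…,s_n). Assume d := R_{1,1} ≠ 0, let y = R_{2:n,1}, wᵀ = R_{1,2:n}, and let R₂ = R_{2:n,2:n} − (1/d)·y·wᵀ be the Schur complement of d in R. Define the updated generators Φ⁽²⁾ = Φ_{2:n,:} − (1/d)·y·Φ_{1,:} and Ψ⁽²⁾ = Ψ_{:,2:n} − (1/d)·Ψ_{:,1}·wᵀ. Then the entries of the Schur complement are recovered from the updated generators by (R₂)_{i,j} = (Φ⁽²⁾_{i,:} Ψ⁽²⁾_{:,j})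 / (t_{i+1} − s_{j+1}) for all 1 ≤ i, j ≤ n−1. -/
/-- **Generator recovery formula for the Schur complement of a Cauchy-type matrix.**
If `D_t R - R D_s = Φ Ψ` with `t i ≠ s j` for all `i, j`, and the pivot `d = R 0 0`
is nonzero, then the entries of the Schur complement
`R₂ = R_{2:n,2:n} - y wᵀ / d` are recovered from the updated generators
`Φ⁽²⁾ = Φ_{2:n,:} - y Φ_{1,:} / d`, `Ψ⁽²⁾ = Ψ_{:,2:n} - Ψ_{:,1} wᵀ / d` via
`(R₂)_{ij} = (Φ⁽²⁾_{i,:} Ψ⁽²⁾_{:,j}) / (t_{i+1} - s_{j+1})`.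
Here the matrix order is `n + 1 ≥ 2` and the generator width is `α ≥ 1`. -/
theorem cauchy_schur_complement_entries
    (n α : ℕ) (hn : 1 ≤ n) (hα : 1 ≤ α)
    (t s : Fin (n + 1) → ℂ) (hts : ∀ i j, t i ≠ s j)
    (R : Matrix (Fin (n + 1)) (Fin (n + 1)) ℂ)
    (Φ : Matrix (Fin (n + 1)) (Fin α) ℂ) (Ψ : Matrix (Fin α) (Fin (n + 1)) ℂ)
    (hdisp : Matrix.diagonal t * R - R * Matrix.diagonal s = Φ * Ψ)
    (hd : R 0 0 ≠ 0) :
    ∀ i j : Fin n,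
      R i.succ j.succ - R i.succ 0 * R 0 j.succ / R 0 0 =
        (∑ a : Fin α,
            (Φ i.succ a - R i.succ 0 * Φ 0 a / R 0 0) *
              (Ψ a j.succ - Ψ a 0 * R 0 j.succ / R 0 0)) /
          (t i.succ - s j.succ) := by
  intro i j
  have h : ∀ p q, ∑ a, Φ p a * Ψ a q = t p * R p q - R p q * s q := by
    intro p q
    have := congrFun (congrFun hdisp p) q
    rw [Matrix.sub_apply, Matrix.diagonal_mul, Matrix.mul_diagonal, Matrix.mul_apply] at this
    exact this.symm
  have hne : t i.succ - s j.succ ≠ 0 := sub_ne_zero.mpr (hts _ _)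
  have hsum : (∑ a : Fin α,
            (Φ i.succ a - R i.succ 0 * Φ 0 a / R 0 0) *
              (Ψ a j.succ - Ψ a 0 * R 0 j.succ / R 0 0)) =
      (∑ a, Φ i.succ a * Ψ a j.succ) - (∑ a, Φ i.succ a * Ψ a 0) * (R 0 j.succ / R 0 0)
      - (R i.succ 0 / R 0 0) * (∑ a, Φ 0 a * Ψ a j.succ)
      + (R i.succ 0 / R 0 0) * (R 0 j.succ / R 0 0) * (∑ a, Φ 0 a * Ψ a 0) := by
    rw [Finset.sum_mul, Finset.mul_sum, Finset.mul_sum, ← Finset.sum_sub_distrib,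
      ← Finset.sum_sub_distrib, ← Finset.sum_add_distrib]
    refine Finset.sum_congr rfl fun a _ => ?_
    ring
  rw [hsum, h, h, h, h, eq_div_iff hne]
  field_simp
  ring
end

section
/- Let n ≥ 1, let F be the n×n unitary DFT matrix with entries F_{k,j} = n^{−1/2} e^{2πi(k−1)(j−1)/n}, let D = diag(1, e^{iπ/n}, …, e^{iπ(n−1)/n}), and let Z_{−1} be the n×n cyclic down-shift matrix with the sign flipped in the corner. Then F D Z_{−1} D^{−1} F* = D_{F−}, where D_{F−} = diag(e^{iπ/n}, e^{3iπ/n}, …, e^{iπ(2n−1)/n}). -/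
open Matrix

/-- The `n × n` matrix `Z₋₁`: entry `(i, j)` is `1` when `i = j + 1`,
the corner entry `(1, n)` is `-1`, and all other entries vanish. -/
def Zneg (n : ℕ) : Matrix (Fin n) (Fin n) ℂ :=
  Matrix.of fun i j =>
    if (i : ℕ) = (j : ℕ) + 1 then 1
    else if (i : ℕ) = 0 ∧ (j : ℕ) = n - 1 then -1 else 0

/-- The `n × n` unitary DFT matrix `F` with entries
`F k j = n^{-1/2} e^{2πi k j / n}` (0-based indices). -/
noncomputable def dftMatrix (n : ℕ) : Matrix (Fin n) (Fin n) ℂ :=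
  Matrix.of fun k j : Fin n =>
    (((Real.sqrt n)⁻¹ : ℝ) : ℂ) *
      Complex.exp (2 * Real.pi * Complex.I * (k : ℕ) * (j : ℕ) / n)

/-- The diagonal matrix `D = diag(1, e^{iπ/n}, …, e^{iπ(n-1)/n})`. -/
noncomputable def Dmat (n : ℕ) : Matrix (Fin n) (Fin n) ℂ :=
  Matrix.diagonal fun k : Fin n => Complex.exp (Real.pi * Complex.I * (k : ℕ) / n)

theorem dft_aux_unitary (n : ℕ) (hn : 1 ≤ n) : dftMatrix n * (dftMatrix n)ᴴ = 1 := by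
  have hn0 : (n : ℂ) ≠ 0 := by exact_mod_cast (by omega : n ≠ 0)
  have hsq : ((Real.sqrt n : ℝ) : ℂ) * ((Real.sqrt n : ℝ) : ℂ) = n := by
    rw [← Complex.ofReal_mul, Real.mul_self_sqrt (by positivity)]; simp
  have hs0 : ((Real.sqrt n : ℝ) : ℂ) ≠ 0 := by
    intro h; rw [h] at hsq; simp at hsq; exact hn0 hsq.symm
  ext k l
  set z : ℂ := Complex.exp (2 * Real.pi * Complex.I * (((k : ℕ) : ℂ) - ((l : ℕ) : ℂ)) / n) with hz
  have key : (dftMatrix n * (dftMatrix n)ᴴ) k l = (n : ℂ)⁻¹ * ∑ j ∈ Finset.range n, z ^ j := by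
    rw [Matrix.mul_apply, ← Fin.sum_univ_eq_sum_range (fun j => z ^ j), Finset.mul_sum]
    refine Finset.sum_congr rfl fun j _ => ?_
    have e1 : z ^ (j : ℕ) = Complex.exp (2 * Real.pi * Complex.I * (k : ℕ) * (j : ℕ) / n) *
        (starRingEnd ℂ) (Complex.exp (2 * Real.pi * Complex.I * (l : ℕ) * (j : ℕ) / n)) := by
      rw [← Complex.exp_conj, ← Complex.exp_add, hz, ← Complex.exp_nat_mul]
      congr 1
      have h2 : (starRingEnd ℂ) 2 = 2 := Complex.conj_ofNat 2
      simp [h2]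
      ring
    have e2 : (n : ℂ)⁻¹ = ((Real.sqrt n : ℝ) : ℂ)⁻¹ * ((Real.sqrt n : ℝ) : ℂ)⁻¹ := by
      rw [← mul_inv, hsq]
    rw [e1, e2]
    simp only [dftMatrix, Matrix.conjTranspose_apply, Matrix.of_apply, star_mul', Complex.star_def,
      Complex.ofReal_inv, map_inv₀, Complex.conj_ofReal]
    ring
  rw [key]
  by_cases hkl : k = l
  · subst hkl
    have : z = 1 := by simp [hz]
    simp [this, hn0]
  · rw [Matrix.one_apply_ne hkl]
    have hzn : z ^ n = 1 := by
      rw [hz, ← Complex.exp_nat_mul, Complex.exp_eq_one_iff]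
      refine ⟨(k : ℕ) - (l : ℕ), ?_⟩
      push_cast
      field_simp
    have hz1 : z ≠ 1 := by
      intro h
      rw [hz, Complex.exp_eq_one_iff] at h
      obtain ⟨m, hm⟩ := h
      have hpi : (2 * Real.pi * Complex.I : ℂ) ≠ 0 := Complex.two_pi_I_ne_zero
      have h2 : (((k : ℕ) : ℂ) - ((l : ℕ) : ℂ)) = m * n := by
        apply mul_left_cancel₀ hpi
        rw [div_eq_iff hn0] at hm
        rw [hm]; ring
      have h3 : ((k : ℕ) : ℤ) - ((l : ℕ) : ℤ) = m * n := by exact_mod_cast h2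
      have hk := k.isLt
      have hl := l.isLt
      have h4 : ((k : ℕ) : ℤ) - ((l : ℕ) : ℤ) = 0 :=
        Int.eq_zero_of_abs_lt_dvd (m := (n : ℤ)) ⟨m, by rw [h3]; ring⟩
          (by rw [abs_lt]; constructor <;> omega)
      exact hkl (Fin.ext (by omega))
    rw [geom_sum_eq hz1, hzn]; simp

theorem dft_aux_comm (n : ℕ) (hn : 1 ≤ n) :
    dftMatrix n * (Dmat n * Zneg n) =
      (Matrix.diagonal fun k : Fin n =>
        Complex.exp (Real.pi * Complex.I * (2 * (k : ℕ) + 1) / n)) * dftMatrix n * Dmat n := by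
  have hn0 : (n : ℂ) ≠ 0 := by exact_mod_cast (by omega : n ≠ 0)
  ext k j
  rw [Matrix.mul_apply]
  simp only [Dmat, Matrix.mul_diagonal, Matrix.diagonal_mul, Zneg, dftMatrix, Matrix.of_apply]
  have hj := j.isLt
  by_cases h : (j : ℕ) + 1 < n
  · rw [Finset.sum_eq_single (⟨(j : ℕ) + 1, h⟩ : Fin n)]
    · simp only [if_true, mul_one, mul_assoc, mul_left_comm (Complex.exp _) (Complex.ofReal _)]
      simp only [← Complex.exp_add]
      congr 2
      push_cast
      field_simp
      ring
    · intro i _ hi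
      have h1 : ¬ (i : ℕ) = (j : ℕ) + 1 := fun e => hi (Fin.ext e)
      have h2 : ¬ ((i : ℕ) = 0 ∧ (j : ℕ) = n - 1) := by omega
      simp [h1, h2]
    · simp
  · rw [Finset.sum_eq_single (⟨0, hn⟩ : Fin n)]
    · have h1 : ¬ (0 = (j : ℕ) + 1) := by omega
      have h2 : (0 = 0 ∧ (j : ℕ) = n - 1) := by omega
      have h3 : ((j : ℕ) : ℂ) = n - 1 := by
        rw [h2.2]; push_cast [hn]; ring
      rw [if_neg h1, if_pos h2, h3]
      simp only [mul_assoc, mul_left_comm (Complex.exp _) (Complex.ofReal _)]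
      simp only [← Complex.exp_add]
      congr 1
      have : (Real.pi * (Complex.I * (2 * ((k : ℕ) : ℂ) + 1)) / n +
          (2 * (Real.pi * (Complex.I * (((k : ℕ) : ℂ) * ((n : ℂ) - 1)))) / n +
          Real.pi * (Complex.I * ((n : ℂ) - 1)) / n)) =
          ((k : ℕ) : ℂ) * (2 * Real.pi * Complex.I) + Real.pi * Complex.I := by
        field_simp
        ring
      rw [this, Complex.exp_add, Complex.exp_nat_mul_two_pi_mul_I, Complex.exp_pi_mul_I]
      simp
    · intro i _ hi
      have h0 : (i : ℕ) ≠ 0 := fun e => hi (Fin.ext e)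
      have h1 : ¬ (i : ℕ) = (j : ℕ) + 1 := by have := i.isLt; omega
      simp [h1, h0]
    · simp

/-- **`F D Z₋₁ D⁻¹ F* = D_{F-}`**, where
`D_{F-} = diag(e^{iπ/n}, e^{3iπ/n}, …, e^{iπ(2n-1)/n})`. -/
theorem dft_diagonalizes_scaled_Zneg (n : ℕ) (hn : 1 ≤ n) :
    dftMatrix n * (Dmat n * Zneg n * (Dmat n)⁻¹) * (dftMatrix n)ᴴ =
      Matrix.diagonal fun k : Fin n =>
        Complex.exp (Real.pi * Complex.I * (2 * (k : ℕ) + 1) / n) := by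
  have hD : IsUnit (Dmat n).det := by
    rw [Dmat, Matrix.det_diagonal, isUnit_iff_ne_zero, Finset.prod_ne_zero_iff]
    exact fun _ _ => Complex.exp_ne_zero _
  rw [← Matrix.mul_assoc (dftMatrix n), dft_aux_comm n hn, Matrix.mul_assoc _ (Dmat n),
    Matrix.mul_nonsing_inv _ hD, Matrix.mul_one, Matrix.mul_assoc, dft_aux_unitary n hn,
    Matrix.mul_one]
end

section
/- Let n ≥ 1 and α ≥ 1. Let T be an n×n complex matrix of Toeplitz type, i.e. satisfying the Sylvester displacement equation Z₁ T − T Z_{−1} = ΩΓ with Ω of size n×α and Γ of size α×n. Then the matrix R = F T D^{−1} F* is of Cauchy type: it satisfies the Sylvester displacement equation D_F R − R D_{F−} = ΦΨ, where Φ = FΩ and Ψ* = F D Γ* (equivalently Ψ = Γ D^{−1} F*). Here F is the n×n unitary DFT matrix, D = diag(1, e^{iπ/n}, …, e^{iπ(n−1)/n}), D_F = diag(1, e^{2πi/n}, …, e^{2πi(n−1)/n}), and D_{F−} = diag(e^{iπ/n}, e^{3iπ/n}, …, e^{iπ(2n−1)/n}). -/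
open Matrix

/-- The `n × n` cyclic down-shift matrix with corner entry `ε`:
`Zcyc n 1` is `Z₁` and `Zcyc n (-1)` is `Z₋₁`. -/
def Zcyc (n : ℕ) (ε : ℂ) : Matrix (Fin n) (Fin n) ℂ :=
  Matrix.of fun i j =>
    if (i : ℕ) = (j : ℕ) + 1 then 1
    else if (i : ℕ) = 0 ∧ (j : ℕ) = n - 1 then ε else 0

/-- The diagonal matrix `D_F = diag(1, e^{2πi/n}, …, e^{2πi(n-1)/n})`. -/
noncomputable def DF (n : ℕ) : Matrix (Fin n) (Fin n) ℂ :=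
  Matrix.diagonal fun k : Fin n => Complex.exp (2 * Real.pi * Complex.I * (k : ℕ) / n)

/-- The diagonal matrix `D_{F-} = diag(e^{iπ/n}, e^{3iπ/n}, …, e^{iπ(2n-1)/n})`. -/
noncomputable def DFminus (n : ℕ) : Matrix (Fin n) (Fin n) ℂ :=
  Matrix.diagonal fun k : Fin n =>
    Complex.exp (Real.pi * Complex.I * (2 * (k : ℕ) + 1) / n)

theorem dft_mul_Z (n : ℕ) (hn : 1 ≤ n) : dftMatrix n * Zcyc n 1 = DF n * dftMatrix n := by
  have hn0 : (n : ℂ) ≠ 0 := by exact_mod_cast (by omega : n ≠ 0)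
  ext k j
  rw [DF, Matrix.diagonal_mul, Matrix.mul_apply]
  by_cases hj : (j : ℕ) + 1 < n
  · rw [Finset.sum_eq_single (⟨j + 1, hj⟩ : Fin n)]
    · simp only [Zcyc, dftMatrix, Matrix.of_apply, if_true, mul_one]
      rw [mul_left_comm, ← Complex.exp_add]
      congr 2
      push_cast
      field_simp
      ring
    · intro b _ hb
      have hb' : (b : ℕ) ≠ j + 1 := fun h => hb (Fin.ext h)
      have : ¬ ((b : ℕ) = 0 ∧ (j : ℕ) = n - 1) := by omega
      simp [Zcyc, hb', this]
    · simp
  · have hjn : (j : ℕ) = n - 1 := by omega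
    rw [Finset.sum_eq_single (⟨0, hn⟩ : Fin n)]
    · have hjc : ((j : ℕ) : ℂ) = n - 1 := by rw [hjn]; push_cast [hn]; ring
      simp only [Zcyc, dftMatrix, Matrix.of_apply, hjn]
      rw [mul_left_comm, ← Complex.exp_add]
      simp
      rw [Nat.cast_sub hn]
      symm
      refine (congrArg _ (Complex.exp_eq_one_iff.mpr ?_)).trans (mul_one _)
      refine ⟨(k : ℕ), ?_⟩
      push_cast
      field_simp
      ring
    · intro b _ hb
      have hb' : (b : ℕ) ≠ 0 := fun h => hb (Fin.ext h)
      have : ¬ ((b : ℕ) = j + 1) := by omega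
      simp [Zcyc, hb', this]
    · simp

theorem Dmat_inv (n : ℕ) : (Dmat n)⁻¹ =
    Matrix.diagonal fun k : Fin n => Complex.exp (-(Real.pi * Complex.I * (k : ℕ) / n)) := by
  apply Matrix.inv_eq_right_inv
  rw [Dmat, Matrix.diagonal_mul_diagonal, ← Matrix.diagonal_one]
  congr 1
  ext k
  rw [← Complex.exp_add]
  simp

theorem DinvF (n : ℕ) (i k : Fin n) : ((Dmat n)⁻¹ * (dftMatrix n)ᴴ) i k =
    (((Real.sqrt n)⁻¹ : ℝ) : ℂ) *
      Complex.exp (-(Real.pi * Complex.I * (2 * (k : ℕ) + 1) * (i : ℕ) / n)) := by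
  rw [Dmat_inv, Matrix.diagonal_mul, Matrix.conjTranspose_apply, dftMatrix, Matrix.of_apply,
    star_mul', mul_left_comm]
  simp only [RCLike.star_def, Complex.conj_ofReal, ← Complex.exp_conj]
  rw [← Complex.exp_add]
  congr 2
  simp only [map_div₀, map_mul, Complex.conj_ofReal, Complex.conj_I, map_natCast, map_ofNat]
  ring

theorem Z_mul_DinvF (n : ℕ) (hn : 1 ≤ n) :
    Zcyc n (-1) * ((Dmat n)⁻¹ * (dftMatrix n)ᴴ) =
      ((Dmat n)⁻¹ * (dftMatrix n)ᴴ) * DFminus n := by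
  have hn0 : (n : ℂ) ≠ 0 := by exact_mod_cast (by omega : n ≠ 0)
  ext i k
  rw [DFminus, Matrix.mul_diagonal, Matrix.mul_apply]
  simp only [DinvF]
  rw [mul_assoc (((Real.sqrt n)⁻¹ : ℝ) : ℂ), ← Complex.exp_add]
  by_cases hi : (i : ℕ) = 0
  · rw [Finset.sum_eq_single (⟨n - 1, by omega⟩ : Fin n)]
    · simp only [Zcyc, Matrix.of_apply, hi]
      rw [if_neg (by omega), if_pos (by simp), mul_left_comm]
      congr 1
      rw [← Complex.exp_pi_mul_I, ← Complex.exp_add, Complex.exp_eq_exp_iff_exists_int]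
      refine ⟨-(k : ℕ), ?_⟩
      rw [Nat.cast_sub hn]
      push_cast
      field_simp
      ring
    · intro b _ hb
      have hb' : (b : ℕ) ≠ n - 1 := fun h => hb (Fin.ext h)
      simp [Zcyc, hb', hi]
    · simp
  · rw [Finset.sum_eq_single (⟨i - 1, by omega⟩ : Fin n)]
    · simp only [Zcyc, Matrix.of_apply]
      rw [if_pos (by omega), one_mul]
      congr 2
      rw [Nat.cast_sub (by omega)]
      push_cast
      field_simp
      ring
    · intro b _ hb
      have hb' : (i : ℕ) ≠ b + 1 := fun h => hb (Fin.ext (by simp; omega))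
      simp [Zcyc, hb', hi]
    · simp

/-- **Toeplitz-to-Cauchy transformation** (GKO, Theorem 2.2).
If `T` is of Toeplitz type, i.e. `Z₁ T - T Z₋₁ = Ω Γ`, then `R = F T D⁻¹ F*`
is of Cauchy type: `D_F R - R D_{F-} = Φ Ψ` with `Φ = F Ω` and
`Ψ = Γ D⁻¹ F*` (equivalently `Ψ* = F D Γ*`). -/
theorem toeplitz_to_cauchy_generators
    (n α : ℕ) (hn : 1 ≤ n) (hα : 1 ≤ α)
    (T : Matrix (Fin n) (Fin n) ℂ)
    (Ω : Matrix (Fin n) (Fin α) ℂ) (Γ : Matrix (Fin α) (Fin n) ℂ)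
    (hdisp : Zcyc n 1 * T - T * Zcyc n (-1) = Ω * Γ) :
    DF n * (dftMatrix n * T * (Dmat n)⁻¹ * (dftMatrix n)ᴴ) -
        (dftMatrix n * T * (Dmat n)⁻¹ * (dftMatrix n)ᴴ) * DFminus n =
      (dftMatrix n * Ω) * (Γ * (Dmat n)⁻¹ * (dftMatrix n)ᴴ) := by
  have h1 := dft_mul_Z n hn
  have h2 := Z_mul_DinvF n hn
  have e1 : DF n * (dftMatrix n * T * (Dmat n)⁻¹ * (dftMatrix n)ᴴ) =
      dftMatrix n * (Zcyc n 1 * T) * ((Dmat n)⁻¹ * (dftMatrix n)ᴴ) := by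
    simp only [← Matrix.mul_assoc, h1]
  have e2 : (dftMatrix n * T * (Dmat n)⁻¹ * (dftMatrix n)ᴴ) * DFminus n =
      dftMatrix n * (T * Zcyc n (-1)) * ((Dmat n)⁻¹ * (dftMatrix n)ᴴ) := by
    rw [Matrix.mul_assoc (dftMatrix n * T), Matrix.mul_assoc (dftMatrix n * T), ← h2]
    simp only [Matrix.mul_assoc]
  rw [e1, e2, ← Matrix.sub_mul, ← Matrix.mul_sub, hdisp]
  simp only [Matrix.mul_assoc]
end

section
/- Let n ≥ 1 and let A, B be n×n complex matrices satisfying the Sylvester displacement equation Z₁ A − A Z_{−1} = B. Then A is recovered from B by wrapped diagonal sums: for all 1 ≤ i, j ≤ n, A_{i,j} = (1/2) [ Σ_{k=j}^{n} B_{1+((i+k−j) mod n), k} − Σ_{k=1}^{j−1} B_{1+((i+k−j) mod n), k} ]. (The paper states this formula without the factor 1/2, which is required for correctness; e.g. for n = 1 one has B = 2A.) -/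
open Matrix

lemma aux_tele (G : ℕ → ℂ) (j m : ℕ) :
    (∑ k ∈ Finset.range m, if j ≤ k then G k - G (k+1) else 0) -
    (∑ k ∈ Finset.range m, if k < j then G k - G (k+1) else 0) =
    if m ≤ j then G m - G 0 else 2 * G j - G 0 - G m := by
  induction m with
  | zero => simp
  | succ m ih =>
    rw [Finset.sum_range_succ, Finset.sum_range_succ, add_sub_add_comm, ih]
    rcases lt_trichotomy m j with h | h | h
    · rw [if_pos h.le, if_neg (by omega), if_pos h, if_pos (by omega)]; ring
    · subst h
      simp; ring
    · rw [if_neg (by omega), if_pos h.le, if_neg (by omega), if_neg (by omega)]; ring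

lemma aux_left (n : ℕ) (hn : 0 < n) (A : Matrix (Fin n) (Fin n) ℂ) (m : ℕ) (k : Fin n) :
    (Zcyc n 1 * A) ⟨(m+1) % n, Nat.mod_lt _ hn⟩ k = A ⟨m % n, Nat.mod_lt _ hn⟩ k := by
  rw [Matrix.mul_apply, Finset.sum_eq_single ⟨m % n, Nat.mod_lt _ hn⟩]
  · have h : Zcyc n 1 ⟨(m+1) % n, Nat.mod_lt _ hn⟩ ⟨m % n, Nat.mod_lt _ hn⟩ = 1 := by
      have h1 := Nat.mod_lt m hn
      simp only [Zcyc, Matrix.of_apply]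
      have h2 : (m+1) % n = (m % n + 1) % n := by simp
      by_cases h : m % n + 1 < n
      · rw [Nat.mod_eq_of_lt h] at h2
        rw [if_pos h2]
      · have h3 : m % n + 1 = n := by omega
        rw [h3, Nat.mod_self] at h2
        rw [if_neg (by omega), if_pos (by omega)]
    rw [h, one_mul]
  · intro b _ hb
    have hb' : (b : ℕ) ≠ m % n := fun h => hb (Fin.ext h)
    have h1 := Nat.mod_lt m hn
    have h2 : (m+1) % n = (m % n + 1) % n := by simp
    have h4 := b.2
    have h : Zcyc n 1 ⟨(m+1) % n, Nat.mod_lt _ hn⟩ b = 0 := by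
      simp only [Zcyc, Matrix.of_apply]
      by_cases h : m % n + 1 < n
      · rw [Nat.mod_eq_of_lt h] at h2
        rw [if_neg (by omega), if_neg (by omega)]
      · have h3 : m % n + 1 = n := by omega
        rw [h3, Nat.mod_self] at h2
        rw [if_neg (by omega), if_neg (by omega)]
    rw [h, zero_mul]
  · simp

lemma aux_right (n : ℕ) (hn : 0 < n) (A : Matrix (Fin n) (Fin n) ℂ) (r k : Fin n) :
    (A * Zcyc n (-1)) r k =
      if h : (k : ℕ) + 1 < n then A r ⟨k + 1, h⟩ else - A r ⟨0, hn⟩ := by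
  have hk := k.2
  rw [Matrix.mul_apply]
  split_ifs with h
  · rw [Finset.sum_eq_single ⟨k + 1, h⟩]
    · simp [Zcyc]
    · intro b _ hb
      have hb' : (b : ℕ) ≠ k + 1 := fun h => hb (Fin.ext h)
      simp only [Zcyc, Matrix.of_apply]
      rw [if_neg hb', if_neg (by omega), mul_zero]
    · simp
  · rw [Finset.sum_eq_single ⟨0, hn⟩]
    · simp only [Zcyc, Matrix.of_apply]
      rw [if_neg (Nat.succ_ne_zero _).symm, if_pos ⟨trivial, by omega⟩]; ring
    · intro b _ hb
      have hb' : (b : ℕ) ≠ 0 := fun h => hb (Fin.ext h)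
      have := b.2
      simp only [Zcyc, Matrix.of_apply]
      rw [if_neg (by omega), if_neg (by omega), mul_zero]
    · simp

/-- **Recovery of a matrix from its `{Z₁, Z₋₁}`-displacement by wrapped diagonal
sums** (Lemma 4.2, corrected by the factor `1/2`).  If `Z₁ A - A Z₋₁ = B`, then
(in 1-based notation)
`A_{i,j} = (1/2) (Σ_{k=j}^{n} B_{1+((i+k-j) mod n), k} - Σ_{k=1}^{j-1} B_{1+((i+k-j) mod n), k})`.
Below, indices are 0-based, so the wrapped row index `(i + k - j + 1) mod n` is
written `(i + k + 1 + (n - j)) % n`. -/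
theorem recover_from_toeplitz_displacement
    (n : ℕ) (hn : 1 ≤ n) (A B : Matrix (Fin n) (Fin n) ℂ)
    (hdisp : Zcyc n 1 * A - A * Zcyc n (-1) = B) :
    ∀ i j : Fin n,
      A i j = (1 / 2) *
        ((∑ k : Fin n, if (j : ℕ) ≤ (k : ℕ) then
            B ⟨((i : ℕ) + (k : ℕ) + 1 + (n - (j : ℕ))) % n,
                Nat.mod_lt _ i.pos⟩ k else 0) -
         (∑ k : Fin n, if (k : ℕ) < (j : ℕ) then
            B ⟨((i : ℕ) + (k : ℕ) + 1 + (n - (j : ℕ))) % n,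
                Nat.mod_lt _ i.pos⟩ k else 0)) := by
  intro i j
  have h0 : 0 < n := hn
  have hj := j.2
  let G : ℕ → ℂ := fun k => if h : k < n then
    A ⟨(i + k + (n - j)) % n, Nat.mod_lt _ h0⟩ ⟨k, h⟩
    else - A ⟨(i + k + (n - j)) % n, Nat.mod_lt _ h0⟩ ⟨0, h0⟩
  have hB : ∀ k : Fin n, B ⟨((i : ℕ) + (k : ℕ) + 1 + (n - (j : ℕ))) % n,
      Nat.mod_lt _ i.pos⟩ k = G k - G (k + 1) := by
    intro k
    have e : (i : ℕ) + (k : ℕ) + 1 + (n - (j : ℕ)) = (i + k + (n - j)) + 1 := by omega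
    have e' : (i : ℕ) + ((k : ℕ) + 1) + (n - (j : ℕ)) = (i + k + (n - j)) + 1 := by omega
    simp only [G, e, e']
    rw [← hdisp, Matrix.sub_apply, aux_left n h0, aux_right n h0, dif_pos k.2]
  simp only [hB]
  rw [← Finset.sum_range (fun k => if (j : ℕ) ≤ k then G k - G (k + 1) else 0),
    ← Finset.sum_range (fun k => if k < (j : ℕ) then G k - G (k + 1) else 0),
    aux_tele, if_neg (by omega)]
  have hGn : G n = - G 0 := by
    have e : ((i : ℕ) + n + (n - j)) % n = (i + 0 + (n - j)) % n := by
      rw [show (i : ℕ) + n + (n - j) = (i + 0 + (n - j)) + n by omega, Nat.add_mod_right]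
    simp only [G, lt_irrefl, dif_neg, not_false_eq_true, dif_pos h0, e]
  have hGj : G j = A i j := by
    have e : ((i : ℕ) + j + (n - j)) % n = i := by
      rw [show (i : ℕ) + j + (n - j) = i + n by omega, Nat.add_mod_right,
        Nat.mod_eq_of_lt i.2]
    simp only [G, dif_pos hj, e]
  rw [hGn, hGj]; ring
end
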